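/- arXiv:2203.06908 — 6 statements merged into one kernel-verified Lean document; each statement's English description precedes it below -/
import Mathlib

section
/- Let λ₀(α₀) be the bounded operator on ℓ²(Γ) determined by λ₀(α₀) e^n_{i,j} = e^{n−1/2}_{i−1/2, j−1/2} if i > −n and j > −n, and λ₀(α₀) e^n_{i,j} = 0 otherwise; and let I⊗π₀(α₀) be the bounded operator on ℓ²(ℕ×ℕ×ℤ) determined by e(r,s,t) ↦ e(r,s−1,t) if s ≥ 1 and e(r,0,t) ↦ 0. Then U ∘ λ₀(α₀) = (I⊗π₀(α₀)) ∘ U; equivalently, U λ₀(α₀) U* = I⊗π₀(α₀). -/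
noncomputable section

/-- The lattice Γ = {(n,i,j) : 2n ∈ ℕ, i,j ∈ {−n,…,n}}, in the integer coordinates
(m,a,b) = (2n, n+i, n+j): Γ = {(m,a,b) ∈ ℕ³ : a ≤ m ∧ b ≤ m}. -/
abbrev GammaIdx : Type := {x : ℕ × ℕ × ℕ // x.2.1 ≤ x.1 ∧ x.2.2 ≤ x.1}

/-- ℓ²(Γ) -/
abbrev l2G : Type := lp (fun _ : GammaIdx => ℂ) 2

/-- ℓ²(ℕ×ℕ×ℤ) -/
abbrev l2Z3 : Type := lp (fun _ : ℕ × ℕ × ℤ => ℂ) 2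

/-- The canonical orthonormal basis vector e^n_{i,j} of ℓ²(Γ), in coordinates
(m,a,b) = (2n, n+i, n+j); by convention it is 0 when (m,a,b) ∉ Γ. -/
def eG (m a b : ℕ) : l2G :=
  if h : a ≤ m ∧ b ≤ m then lp.single 2 (⟨(m, a, b), h⟩ : GammaIdx) 1 else 0

/-- The canonical orthonormal basis vector e(r,s,t) of ℓ²(ℕ×ℕ×ℤ); by convention
it is 0 when r < 0 or s < 0. -/
def eZ (r s t : ℤ) : l2Z3 :=
  if 0 ≤ r ∧ 0 ≤ s then lp.single 2 (r.toNat, s.toNat, t) 1 else 0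

/-- Continuous linear maps on ℓ²(Γ) are determined by their values on the canonical basis. -/
theorem l2G_clm_ext {E : Type*} [NormedAddCommGroup E] [NormedSpace ℂ E] {S T : l2G →L[ℂ] E}
    (h : ∀ m a b : ℕ, a ≤ m → b ≤ m → S (eG m a b) = T (eG m a b)) : S = T := by
  ext ξ
  have hξ := lp.hasSum_single (p := 2) (by norm_num) ξ
  refine (hξ.mapL S).unique ?_
  convert hξ.mapL T using 2 with x
  obtain ⟨⟨m, a, b⟩, ha, hb⟩ := x
  have hx : ∀ c : ℂ, (lp.single 2 (⟨(m, a, b), ha, hb⟩ : GammaIdx) c : l2G) = c • eG m a b := by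
    intro c
    rw [eG, dif_pos ⟨ha, hb⟩, ← lp.single_smul, smul_eq_mul, mul_one]
  rw [hx, map_smul, map_smul, h m a b ha hb]

/-- U λ₀(α₀) U* = I⊗π₀(α₀).  In the coordinates (m,a,b) = (2n, n+i, n+j),
λ₀(α₀) e(m,a,b) = e(m−1,a−1,b−1) if a > 0 and b > 0 (i.e. i > −n and j > −n), and 0 otherwise;
I⊗π₀(α₀) sends e(r,s,t) to e(r,s−1,t) (which is 0 when s = 0). -/
theorem stmt3 (U : l2G ≃ₗᵢ[ℂ] l2Z3)
    (hU : ∀ m a b : ℕ, a ≤ m → b ≤ m →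
      U (eG m a b) = ((-1 : ℂ) ^ (max a b - b)) •
        eZ ((m : ℤ) - (max a b : ℤ)) (min a b) ((b : ℤ) - (a : ℤ)))
    (L : l2G →L[ℂ] l2G)
    (hL : ∀ m a b : ℕ, a ≤ m → b ≤ m →
      L (eG m a b) = if 0 < a ∧ 0 < b then eG (m - 1) (a - 1) (b - 1) else 0)
    (P : l2Z3 →L[ℂ] l2Z3)
    (hP : ∀ (r s : ℕ) (t : ℤ), P (eZ r s t) = eZ r ((s : ℤ) - 1) t) :
    ∀ ξ : l2G, U (L ξ) = P (U ξ) := by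
  let V : l2G →L[ℂ] l2Z3 := U.toContinuousLinearEquiv
  suffices hVP : V.comp L = P.comp V from fun ξ => DFunLike.congr_fun hVP ξ
  refine l2G_clm_ext fun m a b ha hb => ?_
  change U (L (eG m a b)) = P (U (eG m a b))
  have hP' := hP (m - max a b) (min a b) ((b : ℤ) - a)
  rw [Nat.cast_sub (max_le ha hb)] at hP'
  push_cast at hP'
  rw [hL m a b ha hb, hU m a b ha hb, map_smul, hP']
  split_ifs with h
  · rw [hU _ _ _ (by omega) (by omega)]
    congr 2 <;> omega
  · rw [map_zero, eZ, if_neg (by omega), smul_zero]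
end
end

section
/- Let λ₀(β₀) be the bounded operator on ℓ²(Γ) determined by: λ₀(β₀) e^n_{i,j} = −e^{n+1/2}_{i+1/2, j−1/2} if j = −n; λ₀(β₀) e^n_{i,j} = e^{n−1/2}_{i+1/2, j−1/2} if i = −n and j > −n; and λ₀(β₀) e^n_{i,j} = 0 if i > −n and j > −n. Let I⊗π₀(β₀) be the bounded operator on ℓ²(ℕ×ℕ×ℤ) determined by e(r,0,t) ↦ e(r,0,t−1) and e(r,s,t) ↦ 0 for s ≥ 1. Then U ∘ λ₀(β₀) = (I⊗π₀(β₀)) ∘ U; equivalently, U λ₀(β₀) U* = I⊗π₀(β₀). -/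
noncomputable section

/-- U λ₀(β₀) U* = I⊗π₀(β₀).  In the coordinates (m,a,b) = (2n, n+i, n+j),
λ₀(β₀) e(m,a,b) = −e(m+1,a+1,0) if b = 0 (i.e. j = −n);  = e(m−1,0,b−1) if a = 0 and b > 0
(i.e. i = −n and j > −n);  = 0 if a > 0 and b > 0.  I⊗π₀(β₀) sends e(r,0,t) to e(r,0,t−1)
and e(r,s,t) to 0 for s ≥ 1. -/
theorem stmt4 (U : l2G ≃ₗᵢ[ℂ] l2Z3)
    (hU : ∀ m a b : ℕ, a ≤ m → b ≤ m →
      U (eG m a b) = ((-1 : ℂ) ^ (max a b - b)) •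
        eZ ((m : ℤ) - (max a b : ℤ)) (min a b) ((b : ℤ) - (a : ℤ)))
    (L : l2G →L[ℂ] l2G)
    (hL : ∀ m a b : ℕ, a ≤ m → b ≤ m →
      L (eG m a b) =
        if b = 0 then -eG (m + 1) (a + 1) 0
        else if a = 0 then eG (m - 1) 0 (b - 1)
        else 0)
    (P : l2Z3 →L[ℂ] l2Z3)
    (hP : ∀ (r s : ℕ) (t : ℤ), P (eZ r s t) = if s = 0 then eZ r 0 (t - 1) else 0) :
    ∀ ξ : l2G, U (L ξ) = P (U ξ) := by
  suffices h : (U.toContinuousLinearEquiv : l2G →L[ℂ] l2Z3).comp L =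
      P.comp (U.toContinuousLinearEquiv : l2G →L[ℂ] l2Z3) from
    fun ξ => DFunLike.congr_fun h ξ
  refine l2G_clm_ext fun m a b ha hb => ?_
  change U (L (eG m a b)) = P (U (eG m a b))
  rw [hL m a b ha hb, hU m a b ha hb, map_smul]
  have hr : (m : ℤ) - max (a : ℤ) b = ((m - max a b : ℕ) : ℤ) := by
    rw [Nat.cast_sub (max_le ha hb), Nat.cast_max]
  have hP' := hP (m - max a b) (min a b) ((b : ℤ) - a)
  rw [← hr, Nat.cast_min] at hP'
  rw [hP']
  rcases Nat.eq_zero_or_pos b with rfl | hb0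
  · have := hU (m + 1) (a + 1) 0 (by omega) (by omega)
    have e₁ : ((m + 1 : ℕ) : ℤ) - max ((a + 1 : ℕ) : ℤ) (0 : ℕ) = m - a := by omega
    have e₂ : (m : ℤ) - max (a : ℤ) (0 : ℕ) = m - a := by omega
    have e₃ : ((0 : ℕ) : ℤ) - ((a + 1 : ℕ) : ℤ) = ((0 : ℕ) : ℤ) - a - 1 := by omega
    have e₄ : min ((a + 1 : ℕ) : ℤ) (0 : ℕ) = 0 := by omega
    rw [e₁, e₃, e₄] at this
    rw [if_pos rfl, map_neg, this, if_pos (by simp), e₂]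
    simp [pow_succ]
  · rw [if_neg hb0.ne']
    rcases Nat.eq_zero_or_pos a with rfl | ha0
    · have := hU (m - 1) 0 (b - 1) (by omega) (by omega)
      have e₁ : ((m - 1 : ℕ) : ℤ) - max ((0 : ℕ) : ℤ) ((b - 1 : ℕ) : ℤ) =
          m - max ((0 : ℕ) : ℤ) b := by omega
      have e₂ : ((b - 1 : ℕ) : ℤ) - ((0 : ℕ) : ℤ) = b - ((0 : ℕ) : ℤ) - 1 := by omega
      have e₃ : min ((0 : ℕ) : ℤ) ((b - 1 : ℕ) : ℤ) = 0 := by omega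
      rw [e₁, e₂, e₃] at this
      rw [if_pos rfl, this, if_pos (by simp)]
      simp
    · rw [if_neg ha0.ne', if_neg (by omega), map_zero, smul_zero]
end
end

section
/- Let q be real with 0 < |q| < 1, and let A and B be the bounded operators on ℓ²(ℕ×ℤ) determined by A e(s,t) = g(s) e(s−1,t) (so A e(0,t) = 0, since g(0) = 0) and B e(s,t) = q^s e(s,t−1). Then the defining relations of C(SU_q(2)) hold: A*A + B*B = I, AA* + q² BB* = I, AB = q·BA, AB* = q·B*A, and B*B = BB*. -/
noncomputable section

/-- ℓ²(ℕ×ℤ) -/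
abbrev l2NZ : Type := lp (fun _ : ℕ × ℤ => ℂ) 2

/-- The canonical orthonormal basis vector e(s,t) of ℓ²(ℕ×ℤ); by convention
it is 0 when s < 0. -/
def eNZ (s t : ℤ) : l2NZ :=
  if 0 ≤ s then lp.single 2 (s.toNat, t) 1 else 0

/-- g(k) = (1 − q^{2k})^{1/2}  (so g(0) = 0). -/
def gq (q : ℝ) (k : ℕ) : ℝ := Real.sqrt (1 - q ^ (2 * k))

theorem eNZ_natCast (s : ℕ) (t : ℤ) : eNZ s t = lp.single 2 (s, t) 1 := by
  simp [eNZ]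

theorem inner_eNZ_left (s : ℕ) (t : ℤ) (x : l2NZ) : inner ℂ (eNZ s t) x = x (s, t) := by
  rw [eNZ_natCast, lp.inner_single_left]
  simp

theorem eNZ_apply (s : ℕ) (t : ℤ) (p : ℕ × ℤ) :
    eNZ s t p = if p = (s, t) then 1 else 0 := by
  rw [eNZ_natCast, lp.single_apply, Pi.single_apply]

/-- Bounded operators on ℓ²(ℕ×ℤ) are determined by the canonical basis. -/
theorem clm_ext_eNZ {S T : l2NZ →L[ℂ] l2NZ}
    (h : ∀ (s : ℕ) (t : ℤ), S (eNZ s t) = T (eNZ s t)) : S = T := by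
  ext1 x
  have hx := lp.hasSum_single (p := 2) (by simp) x
  refine (hx.mapL S).unique ?_
  convert hx.mapL T using 2 with p
  have hp : lp.single 2 p (x p) = x p • eNZ p.1 p.2 := by
    rw [eNZ_natCast, ← lp.single_smul]
    simp
  rw [hp, map_smul, map_smul, h]

theorem adjoint_apply_eq_of_eNZ {T : l2NZ →L[ℂ] l2NZ} {x y : l2NZ}
    (h : ∀ (s : ℕ) (t : ℤ), inner ℂ (T (eNZ s t)) x = y (s, t)) :
    ContinuousLinearMap.adjoint T x = y := by
  ext ⟨s, t⟩
  rw [← h, ← inner_eNZ_left, ContinuousLinearMap.adjoint_inner_right]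

theorem gq_mul_self {q : ℝ} (hq : |q| < 1) (k : ℕ) :
    gq q k * gq q k = 1 - q ^ (2 * k) := by
  refine Real.mul_self_sqrt (sub_nonneg.2 ?_)
  rw [pow_mul]
  exact pow_le_one₀ (sq_nonneg q) ((sq_lt_one_iff_abs_lt_one q).2 hq).le

open ContinuousLinearMap in
/-- the operators A e(s,t) = g(s) e(s−1,t) and B e(s,t) = q^s e(s,t−1) on
ℓ²(ℕ×ℤ) satisfy the defining relations of C(SU_q(2)):
A*A + B*B = I,  AA* + q² BB* = I,  AB = q·BA,  AB* = q·B*A,  B*B = BB*. -/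
theorem stmt5 (q : ℝ) (h0 : 0 < |q|) (h1 : |q| < 1)
    (A B : l2NZ →L[ℂ] l2NZ)
    (hA : ∀ (s : ℕ) (t : ℤ), A (eNZ s t) = ((gq q s : ℝ) : ℂ) • eNZ ((s : ℤ) - 1) t)
    (hB : ∀ (s : ℕ) (t : ℤ), B (eNZ s t) = ((q ^ s : ℝ) : ℂ) • eNZ s (t - 1)) :
    adjoint A ∘L A + adjoint B ∘L B = 1 ∧
    A ∘L adjoint A + ((q : ℂ) ^ 2) • (B ∘L adjoint B) = 1 ∧
    A ∘L B = (q : ℂ) • (B ∘L A) ∧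
    A ∘L adjoint B = (q : ℂ) • (adjoint B ∘L A) ∧
    adjoint B ∘L B = B ∘L adjoint B := by
  have hA0 (t : ℤ) : A (eNZ (0 : ℕ) t) = 0 := by
    rw [hA]
    simp [gq]
  have hA1 (s : ℕ) (t : ℤ) :
      A (eNZ (s + 1 : ℕ) t) = ((gq q (s + 1) : ℝ) : ℂ) • eNZ s t := by
    rw [hA]
    simp
  have hA' (s : ℕ) (t : ℤ) :
      adjoint A (eNZ s t) = ((gq q (s + 1) : ℝ) : ℂ) • eNZ (s + 1 : ℕ) t := by
    refine adjoint_apply_eq_of_eNZ fun s' t' => ?_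
    rw [lp.coeFn_smul, Pi.smul_apply, eNZ_apply]
    cases s' with
    | zero => rw [hA0, inner_zero_left, if_neg (by simp), smul_zero]
    | succ k =>
      rw [hA1, inner_smul_left, inner_eNZ_left, eNZ_apply, Complex.conj_ofReal, smul_eq_mul]
      by_cases hk : k = s <;> simp [hk]
  have hB' (s : ℕ) (t : ℤ) :
      adjoint B (eNZ s t) = ((q ^ s : ℝ) : ℂ) • eNZ s (t + 1) := by
    refine adjoint_apply_eq_of_eNZ fun s' t' => ?_
    rw [lp.coeFn_smul, Pi.smul_apply, hB, inner_smul_left, inner_eNZ_left, eNZ_apply, eNZ_apply,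
      Complex.conj_ofReal, smul_eq_mul]
    by_cases hs : s' = s
    · simp [hs, sub_eq_iff_eq_add]
    · simp [hs]
  have hg (k : ℕ) : ((gq q k : ℝ) : ℂ) * ((gq q k : ℝ) : ℂ) = 1 - (q : ℂ) ^ (2 * k) := by
    exact_mod_cast congrArg Complex.ofReal (gq_mul_self h1 k)
  refine ⟨clm_ext_eNZ fun s t => ?_, clm_ext_eNZ fun s t => ?_, clm_ext_eNZ fun s t => ?_,
    clm_ext_eNZ fun s t => ?_, clm_ext_eNZ fun s t => ?_⟩
  · cases s with
    | zero =>
      simp only [add_apply, comp_apply, one_apply_eq_self, hA0, hB, hB', map_zero,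
        sub_add_cancel, pow_zero, Complex.ofReal_one, one_smul, zero_add]
    | succ k =>
      simp only [add_apply, comp_apply, one_apply_eq_self, hA1, hA', hB, hB', map_smul, smul_smul, hg,
        sub_add_cancel, ← add_smul]
      convert one_smul ℂ _ using 2
      push_cast
      ring
  · simp only [add_apply, smul_apply, comp_apply, one_apply_eq_self, hA1, hA', hB, hB', map_smul,
      smul_smul, hg, add_sub_cancel_right, ← add_smul]
    convert one_smul ℂ _ using 2
    push_cast
    ring
  · cases s with
    | zero => simp only [smul_apply, comp_apply, hA0, hB, map_smul, map_zero, smul_zero]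
    | succ k =>
      simp only [smul_apply, comp_apply, hA1, hB, map_smul, smul_smul]
      congr 1
      push_cast
      ring
  · cases s with
    | zero => simp only [smul_apply, comp_apply, hA0, hB', map_smul, map_zero, smul_zero]
    | succ k =>
      simp only [smul_apply, comp_apply, hA1, hB', map_smul, smul_smul]
      congr 1
      push_cast
      ring
  · simp only [comp_apply, hB, hB', map_smul, sub_add_cancel, add_sub_cancel_right]
end
end

section
/- For 0 < |q| < 1, the assignments e^n_{i,j} ↦ a₊(n,i,j) e^{n+1/2}_{i−1/2,j−1/2} + a₋(n,i,j) e^{n−1/2}_{i−1/2,j−1/2} and e^n_{i,j} ↦ b₊(n,i,j) e^{n+1/2}_{i+1/2,j−1/2} + b₋(n,i,j) e^{n−1/2}_{i+1/2,j−1/2} (with the a₋ and b₋ terms omitted when n = 0) extend to bounded linear operators λ_q(α_q) and λ_q(β_q) on ℓ²(Γ), each of operator norm at most 2. In particular, all the coefficients a₊, a₋, b₊, b₋ have absolute value at most 1. -/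
noncomputable section

/-- a₊(n,i,j) = q^{2n+i+j+1} g(n−j+1)g(n−i+1)/(g(2n+1)g(2n+2)), in coordinates
(m,a,b) = (2n, n+i, n+j): a₊ = q^{a+b+1} g(m−b+1)g(m−a+1)/(g(m+1)g(m+2)). -/
def aP (q : ℝ) (m a b : ℕ) : ℝ :=
  q ^ (a + b + 1) * gq q (m - b + 1) * gq q (m - a + 1) / (gq q (m + 1) * gq q (m + 2))

/-- a₋(n,i,j) = g(n+j)g(n+i)/(g(2n)g(2n+1)), i.e. a₋ = g(b)g(a)/(g(m)g(m+1)) (for m ≥ 1). -/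
def aM (q : ℝ) (m a b : ℕ) : ℝ :=
  gq q b * gq q a / (gq q m * gq q (m + 1))

/-- b₊(n,i,j) = −q^{n+j} g(n−j+1)g(n+i+1)/(g(2n+1)g(2n+2)), i.e.
b₊ = −q^b g(m−b+1)g(a+1)/(g(m+1)g(m+2)). -/
def bP (q : ℝ) (m a b : ℕ) : ℝ :=
  -(q ^ b * gq q (m - b + 1) * gq q (a + 1)) / (gq q (m + 1) * gq q (m + 2))

/-- b₋(n,i,j) = q^{n+i} g(n+j)g(n−i)/(g(2n)g(2n+1)), i.e.
b₋ = q^a g(b)g(m−a)/(g(m)g(m+1)) (for m ≥ 1). -/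
def bM (q : ℝ) (m a b : ℕ) : ℝ :=
  q ^ a * gq q b * gq q (m - a) / (gq q m * gq q (m + 1))

/-- λ_q(α_q): in coordinates (m,a,b), e(m,a,b) ↦ a₊ e(m+1,a,b) + a₋ e(m−1,a−1,b−1),
the a₋ term being omitted when m = 0 (i.e. n = 0). -/
def IsLambdaAlpha (q : ℝ) (L : l2G →L[ℂ] l2G) : Prop :=
  ∀ m a b : ℕ, a ≤ m → b ≤ m →
    L (eG m a b) = ((aP q m a b : ℝ) : ℂ) • eG (m + 1) a b +
      (if 1 ≤ m then ((aM q m a b : ℝ) : ℂ) • eG (m - 1) (a - 1) (b - 1) else 0)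

/-- λ_q(β_q): in coordinates (m,a,b), e(m,a,b) ↦ b₊ e(m+1,a+1,b) + b₋ e(m−1,a,b−1),
the b₋ term being omitted when m = 0 (i.e. n = 0). -/
def IsLambdaBeta (q : ℝ) (L : l2G →L[ℂ] l2G) : Prop :=
  ∀ m a b : ℕ, a ≤ m → b ≤ m →
    L (eG m a b) = ((bP q m a b : ℝ) : ℂ) • eG (m + 1) (a + 1) b +
      (if 1 ≤ m then ((bM q m a b : ℝ) : ℂ) • eG (m - 1) a (b - 1) else 0)

/-- The defining property of the unitary U : ℓ²(Γ) → ℓ²(ℕ×ℕ×ℤ):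
U e^n_{i,j} = (−1)^{max(i,j)−j} e(n−max(i,j), n+min(i,j), j−i), i.e.
U e(m,a,b) = (−1)^{max(a,b)−b} e(m−max(a,b), min(a,b), b−a). -/
def IsU (U : l2G ≃ₗᵢ[ℂ] l2Z3) : Prop :=
  ∀ m a b : ℕ, a ≤ m → b ≤ m →
    U (eG m a b) = ((-1 : ℂ) ^ (max a b - b)) •
      eZ ((m : ℤ) - (max a b : ℤ)) (min a b) ((b : ℤ) - (a : ℤ))

section WeightedComposition

variable {ι : Type*}

theorem sum_norm_mul_comp_rpow_le {c : ι → ℂ} {s : ι → ι} (hc : ∀ i, ‖c i‖ ≤ 1)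
    (hs : Set.InjOn s {i | c i ≠ 0}) (x : lp (fun _ : ι => ℂ) 2) (F : Finset ι) :
    ∑ i ∈ F, ‖c i * x (s i)‖ ^ (2 : ENNReal).toReal ≤ ‖x‖ ^ (2 : ENNReal).toReal := by
  classical
  calc ∑ i ∈ F, ‖c i * x (s i)‖ ^ (2 : ENNReal).toReal
      = ∑ i ∈ F with c i ≠ 0, ‖c i * x (s i)‖ ^ (2 : ENNReal).toReal := by
        refine (Finset.sum_filter_of_ne (p := fun i => c i ≠ 0) fun i _ h hi => h ?_).symm
        simp [hi]
    _ ≤ ∑ i ∈ F with c i ≠ 0, ‖x (s i)‖ ^ (2 : ENNReal).toReal := by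
        refine Finset.sum_le_sum fun i _ => Real.rpow_le_rpow (norm_nonneg _) ?_ (by simp)
        rw [norm_mul]
        exact mul_le_of_le_one_left (norm_nonneg _) (hc i)
    _ = ∑ k ∈ (F.filter fun i => c i ≠ 0).image s, ‖x k‖ ^ (2 : ENNReal).toReal := by
        refine (Finset.sum_image (f := fun k => ‖x k‖ ^ (2 : ENNReal).toReal) ?_).symm
        exact hs.mono fun i hi => (Finset.mem_filter.mp hi).2
    _ ≤ ‖x‖ ^ (2 : ENNReal).toReal := lp.sum_rpow_le_norm_rpow (by simp) x _

theorem exists_weighted_comp {c : ι → ℂ} {s : ι → ι} (hc : ∀ i, ‖c i‖ ≤ 1)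
    (hs : Set.InjOn s {i | c i ≠ 0}) :
    ∃ P : lp (fun _ : ι => ℂ) 2 →L[ℂ] lp (fun _ : ι => ℂ) 2,
      (∀ x i, P x i = c i * x (s i)) ∧ ‖P‖ ≤ 1 := by
  let P : lp (fun _ : ι => ℂ) 2 →ₗ[ℂ] lp (fun _ : ι => ℂ) 2 :=
    { toFun := fun x => ⟨fun i => c i * x (s i),
        memℓp_gen' (sum_norm_mul_comp_rpow_le hc hs x)⟩
      map_add' := fun x y => by
        ext i
        exact mul_add _ _ _
      map_smul' := fun r x => by
        ext i
        exact mul_left_comm _ _ _ }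
  refine ⟨P.mkContinuous 1 fun x => ?_, fun x i => rfl, P.mkContinuous_norm_le zero_le_one _⟩
  rw [one_mul]
  exact lp.norm_le_of_forall_sum_le (by simp) (norm_nonneg _)
    (sum_norm_mul_comp_rpow_le hc hs x)

theorem exists_weighted_shift [DecidableEq ι] {c : ι → ℂ} {s : ι → ι} (hc : ∀ i, ‖c i‖ ≤ 1)
    (hs : Set.InjOn s {i | c i ≠ 0}) :
    ∃ T : lp (fun _ : ι => ℂ) 2 →L[ℂ] lp (fun _ : ι => ℂ) 2,
      (∀ i, T (lp.single 2 i 1) = c i • lp.single 2 (s i) 1) ∧ ‖T‖ ≤ 1 := by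
  obtain ⟨P, hP, hP1⟩ := exists_weighted_comp (c := fun i => star (c i)) (s := s)
    (by simpa using hc) (by simpa using hs)
  refine ⟨P.adjoint, fun i => ext_inner_right ℂ fun y => ?_, ?_⟩
  · rw [ContinuousLinearMap.adjoint_inner_left, inner_smul_left, lp.inner_single_left,
      lp.inner_single_left, hP]
    simp
  · rwa [LinearIsometryEquiv.norm_map]

end WeightedComposition

section Coefficients

theorem gq_nonneg (q : ℝ) (k : ℕ) : 0 ≤ gq q k := Real.sqrt_nonneg _

@[simp] theorem gq_zero (q : ℝ) : gq q 0 = 0 := by simp [gq]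

theorem gq_mono {q : ℝ} (h1 : |q| < 1) : Monotone (gq q) := by
  intro k l h
  refine Real.sqrt_le_sqrt (sub_le_sub_left ?_ 1)
  rw [pow_mul, pow_mul]
  exact pow_le_pow_of_le_one (sq_nonneg q) (sq_le_one_iff_abs_le_one q |>.mpr h1.le) h

theorem abs_mul_gq_div_le_one {q : ℝ} (h1 : |q| < 1) (n : ℕ) {k l k' l' : ℕ}
    (hk : k ≤ k') (hl : l ≤ l') :
    |q ^ n * gq q k * gq q l / (gq q k' * gq q l')| ≤ 1 := by
  have hnum : |q ^ n * gq q k * gq q l| ≤ gq q k' * gq q l' := by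
    rw [abs_mul, abs_mul, abs_pow, abs_of_nonneg (gq_nonneg q k), abs_of_nonneg (gq_nonneg q l)]
    refine mul_le_mul ?_ (gq_mono h1 hl) (gq_nonneg q l) (gq_nonneg q k')
    exact (mul_le_of_le_one_left (gq_nonneg q k) (pow_le_one₀ (abs_nonneg q) h1.le)).trans
      (gq_mono h1 hk)
  rw [abs_div]
  exact div_le_one_of_le₀ (hnum.trans (le_abs_self _)) (abs_nonneg _)

theorem abs_aP_le_one {q : ℝ} (h1 : |q| < 1) {m a b : ℕ} : |aP q m a b| ≤ 1 :=
  abs_mul_gq_div_le_one h1 _ (by omega) (by omega)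

theorem abs_aM_le_one {q : ℝ} (h1 : |q| < 1) {m a b : ℕ}
    (ha : a ≤ m) (hb : b ≤ m) : |aM q m a b| ≤ 1 := by
  have := abs_mul_gq_div_le_one h1 0 hb (ha.trans m.le_succ)
  rwa [pow_zero, one_mul] at this

theorem abs_bP_le_one {q : ℝ} (h1 : |q| < 1) {m a b : ℕ} (ha : a ≤ m) : |bP q m a b| ≤ 1 := by
  rw [bP, neg_div, abs_neg]
  exact abs_mul_gq_div_le_one h1 _ (by omega) (by omega)

theorem abs_bM_le_one {q : ℝ} (h1 : |q| < 1) {m a b : ℕ} (hb : b ≤ m) : |bM q m a b| ≤ 1 :=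
  abs_mul_gq_div_le_one h1 _ hb (by omega)

end Coefficients

theorem eG_of_le {m a b : ℕ} (h : a ≤ m ∧ b ≤ m) :
    eG m a b = lp.single 2 (⟨(m, a, b), h⟩ : GammaIdx) 1 := dif_pos h

theorem exists_lattice_shift (c : ℕ → ℕ → ℕ → ℝ) (s : ℕ → ℕ → ℕ → ℕ × ℕ × ℕ)
    (hc : ∀ m a b, a ≤ m → b ≤ m → |c m a b| ≤ 1)
    (hmem : ∀ m a b, a ≤ m → b ≤ m → c m a b ≠ 0 →
      (s m a b).2.1 ≤ (s m a b).1 ∧ (s m a b).2.2 ≤ (s m a b).1)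
    (hinj : ∀ m a b m' a' b', c m a b ≠ 0 → c m' a' b' ≠ 0 → s m a b = s m' a' b' →
      m = m' ∧ a = a' ∧ b = b') :
    ∃ T : l2G →L[ℂ] l2G, (∀ m a b, a ≤ m → b ≤ m →
      T (eG m a b) = (c m a b : ℂ) • eG (s m a b).1 (s m a b).2.1 (s m a b).2.2) ∧ ‖T‖ ≤ 1 := by
  classical
  let t : GammaIdx → GammaIdx := fun x =>
    if h : (s x.1.1 x.1.2.1 x.1.2.2).2.1 ≤ (s x.1.1 x.1.2.1 x.1.2.2).1 ∧
      (s x.1.1 x.1.2.1 x.1.2.2).2.2 ≤ (s x.1.1 x.1.2.1 x.1.2.2).1 then ⟨_, h⟩ else x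
  have ht : ∀ x : GammaIdx, c x.1.1 x.1.2.1 x.1.2.2 ≠ 0 →
      (t x).1 = s x.1.1 x.1.2.1 x.1.2.2 := fun x hx => by
    simp only [t]
    rw [dif_pos (hmem _ _ _ x.2.1 x.2.2 hx)]
  obtain ⟨T, hT, hT1⟩ := exists_weighted_shift
    (c := fun x : GammaIdx => (c x.1.1 x.1.2.1 x.1.2.2 : ℂ)) (s := t)
    (fun x => by simpa using hc _ _ _ x.2.1 x.2.2) (by
      intro x hx y hy hxy
      have hx' : c x.1.1 x.1.2.1 x.1.2.2 ≠ 0 := Complex.ofReal_ne_zero.mp hx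
      have hy' : c y.1.1 y.1.2.1 y.1.2.2 ≠ 0 := Complex.ofReal_ne_zero.mp hy
      have h := hinj _ _ _ _ _ _ hx' hy' (by rw [← ht x hx', ← ht y hy', hxy])
      exact Subtype.ext (Prod.ext h.1 (Prod.ext h.2.1 h.2.2)))
  refine ⟨T, fun m a b ha hb => ?_, hT1⟩
  rw [eG_of_le ⟨ha, hb⟩, hT]
  by_cases h : c m a b = 0
  · simp [h]
  · have hm := hmem m a b ha hb h
    rw [eG_of_le hm]
    congr 3
    exact Subtype.ext (ht ⟨(m, a, b), ha, hb⟩ h)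

theorem aM_ne_zero {q : ℝ} {m a b : ℕ} (h : aM q m a b ≠ 0) : m ≠ 0 ∧ a ≠ 0 ∧ b ≠ 0 := by
  refine ⟨?_, ?_, ?_⟩ <;> rintro rfl <;> simp [aM] at h

theorem bM_ne_zero {q : ℝ} {m a b : ℕ} (h : bM q m a b ≠ 0) : m ≠ 0 ∧ a < m ∧ b ≠ 0 := by
  refine ⟨?_, ?_, ?_⟩
  · rintro rfl
    simp [bM] at h
  · by_contra! hm
    simp [bM, Nat.sub_eq_zero_of_le hm] at h
  · rintro rfl
    simp [bM] at h

theorem norm_add_le_two {S T : l2G →L[ℂ] l2G} (hS : ‖S‖ ≤ 1) (hT : ‖T‖ ≤ 1) : ‖S + T‖ ≤ 2 :=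
  (norm_add_le S T).trans (by linarith)

theorem exists_isLambdaAlpha {q : ℝ} (h1 : |q| < 1) :
    ∃ L : l2G →L[ℂ] l2G, IsLambdaAlpha q L ∧ ‖L‖ ≤ 2 := by
  obtain ⟨S, hS, hS1⟩ := exists_lattice_shift (aP q) (fun m a b => (m + 1, a, b))
    (fun m a b _ _ => abs_aP_le_one h1) (fun m a b _ _ _ => by dsimp only; omega)
    (fun m a b m' a' b' _ _ h => by simpa using h)
  obtain ⟨T, hT, hT1⟩ := exists_lattice_shift (aM q) (fun m a b => (m - 1, a - 1, b - 1))
    (fun m a b => abs_aM_le_one h1) (fun m a b _ _ _ => by dsimp only; omega)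
    (fun m a b m' a' b' h h' e => by
      have := aM_ne_zero h
      have := aM_ne_zero h'
      simp only [Prod.mk.injEq] at e
      omega)
  refine ⟨S + T, fun m a b ha hb => ?_, norm_add_le_two hS1 hT1⟩
  rw [add_apply, hS m a b ha hb, hT m a b ha hb]
  split_ifs with hm
  · rfl
  · obtain rfl : m = 0 := by omega
    simp [aM]

theorem exists_isLambdaBeta {q : ℝ} (h1 : |q| < 1) :
    ∃ L : l2G →L[ℂ] l2G, IsLambdaBeta q L ∧ ‖L‖ ≤ 2 := by
  obtain ⟨S, hS, hS1⟩ := exists_lattice_shift (bP q) (fun m a b => (m + 1, a + 1, b))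
    (fun m a b ha _ => abs_bP_le_one h1 ha) (fun m a b _ _ _ => by dsimp only; omega)
    (fun m a b m' a' b' _ _ h => by simpa using h)
  obtain ⟨T, hT, hT1⟩ := exists_lattice_shift (bM q) (fun m a b => (m - 1, a, b - 1))
    (fun m a b _ hb => abs_bM_le_one h1 hb)
    (fun m a b _ _ h => by
      have := bM_ne_zero h
      dsimp only
      omega)
    (fun m a b m' a' b' h h' e => by
      have := bM_ne_zero h
      have := bM_ne_zero h'
      simp only [Prod.mk.injEq] at e
      omega)
  refine ⟨S + T, fun m a b ha hb => ?_, norm_add_le_two hS1 hT1⟩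
  rw [add_apply, hS m a b ha hb, hT m a b ha hb]
  split_ifs with hm
  · rfl
  · obtain rfl : m = 0 := by omega
    simp [bM]

/-- for 0 < |q| < 1, the Clebsch–Gordan assignments extend to bounded
operators λ_q(α_q), λ_q(β_q) on ℓ²(Γ) of norm at most 2, and all the coefficients
a₊, a₋, b₊, b₋ have absolute value at most 1. -/
theorem stmt9 (q : ℝ) (h0 : 0 < |q|) (h1 : |q| < 1) :
    (∃ Lα : l2G →L[ℂ] l2G, IsLambdaAlpha q Lα ∧ ‖Lα‖ ≤ 2) ∧
    (∃ Lβ : l2G →L[ℂ] l2G, IsLambdaBeta q Lβ ∧ ‖Lβ‖ ≤ 2) ∧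
    (∀ m a b : ℕ, a ≤ m → b ≤ m →
      |aP q m a b| ≤ 1 ∧ |bP q m a b| ≤ 1 ∧
      (1 ≤ m → |aM q m a b| ≤ 1 ∧ |bM q m a b| ≤ 1)) := by
  exact ⟨exists_isLambdaAlpha h1, exists_isLambdaBeta h1, fun m a b ha hb =>
    ⟨abs_aP_le_one h1, abs_bP_le_one h1 ha, fun _ => ⟨abs_aM_le_one h1 ha hb, abs_bM_le_one h1 hb⟩⟩⟩
end
end

section
/- Let q be real with 0 < |q| < 1. The diagonal operator on ℓ²(ℕ×ℕ×ℤ) with symbol d₁(r,s,t) = q^{2s+|t|+1} · [g(r+t₋+1)g(r+t₊+1)/(g(r+s+|t|+1)g(r+s+|t|+2)) − 1] is a compact operator. (Moreover there is a constant C > 0 with |d₁(r,s,t)| ≤ C·|q|^{2r+2s+|t|} for all (r,s,t).) -/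
noncomputable section

/-- The canonical orthonormal basis vector e(r,s,t) of ℓ²(ℕ×ℕ×ℤ). -/
def e3 (r s : ℕ) (t : ℤ) : l2Z3 := lp.single 2 (r, s, t) 1

/-- d₁(r,s,t) = q^{2s+|t|+1} [g(r+t₋+1)g(r+t₊+1)/(g(r+s+|t|+1)g(r+s+|t|+2)) − 1]. -/
def d1 (q : ℝ) (r s : ℕ) (t : ℤ) : ℝ :=
  q ^ (2 * s + t.natAbs + 1) *
    (gq q (r + (-t).toNat + 1) * gq q (r + t.toNat + 1) /
      (gq q (r + s + t.natAbs + 1) * gq q (r + s + t.natAbs + 2)) - 1)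

/-- A diagonal operator on `ℓ²(ι)` whose symbol is absolutely summable exists as a bounded operator
and is compact. -/
theorem exists_isCompactOperator_diagonal {ι : Type*} [DecidableEq ι] (d : ι → ℂ)
    (hd : Summable fun i => ‖d i‖) :
    ∃ D : lp (fun _ : ι => ℂ) 2 →L[ℂ] lp (fun _ : ι => ℂ) 2,
      (∀ i, D (lp.single 2 i 1) = d i • lp.single 2 i 1) ∧ IsCompactOperator (⇑D) := by
  let e : ι → lp (fun _ : ι => ℂ) 2 := fun i => lp.single 2 i 1
  have he : ∀ i, ‖e i‖ = 1 := fun i => by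
    simp only [e]
    rw [lp.norm_single (by norm_num), norm_one]
  let P : ι → lp (fun _ : ι => ℂ) 2 →L[ℂ] lp (fun _ : ι => ℂ) 2 :=
    fun i => (innerSL ℂ (e i)).smulRight (e i)
  have hP : ∀ i, ‖P i‖ = 1 := fun i => by
    simp only [P]
    rw [ContinuousLinearMap.norm_smulRight_apply, innerSL_apply_norm, he, one_mul]
  have hPc : ∀ i, IsCompactOperator (⇑(P i)) := fun i =>
    (isCompactOperator_of_locallyCompactSpace_dom (innerSL ℂ (e i))).clm_comp
      ((ContinuousLinearMap.id ℂ ℂ).smulRight (e i))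
  have hs : Summable fun i => d i • P i := by
    refine Summable.of_norm (hd.congr fun i => ?_)
    rw [norm_smul, hP, mul_one]
  refine ⟨∑' i, d i • P i, fun j => ?_, ?_⟩
  · have h := (ContinuousLinearMap.apply ℂ (lp (fun _ : ι => ℂ) 2) (e j)).hasSum hs.hasSum
    refine h.unique ?_
    have hj : (d j • lp.single 2 j 1 : lp (fun _ : ι => ℂ) 2) =
        ContinuousLinearMap.apply ℂ (lp (fun _ : ι => ℂ) 2) (e j) (d j • P j) := by
      simp [P, e]
    rw [hj]
    refine hasSum_single j fun i hij => ?_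
    simp [P, e, lp.inner_single_left, hij]
  · refine isClosed_setOfPred_isCompactOperator.mem_of_tendsto hs.hasSum
      (Filter.Eventually.of_forall fun s => ?_)
    exact Submodule.sum_mem (compactOperator (RingHom.id ℂ) _ _)
      fun i _ => (hPc i).smul (d i)

/-- If `a, b, c, d ∈ [1 - y, 1]` with `1 - y > 0`, then `√a √b / (√c √d)` differs from `1` by at most
`y / (1 - y)`. -/
theorem abs_sqrt_mul_sqrt_div_sub_one_le {y a b c d : ℝ} (hy : y < 1)
    (ha : 1 - y ≤ a) (ha1 : a ≤ 1) (hb : 1 - y ≤ b) (hb1 : b ≤ 1)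
    (hc : 1 - y ≤ c) (hc1 : c ≤ 1) (hd : 1 - y ≤ d) (hd1 : d ≤ 1) :
    |√a * √b / (√c * √d) - 1| ≤ y / (1 - y) := by
  have hy0 : 0 < 1 - y := by linarith
  have key : ∀ {u v : ℝ}, 1 - y ≤ u → u ≤ 1 → 1 - y ≤ v → v ≤ 1 →
      1 - y ≤ √u * √v ∧ √u * √v ≤ 1 := by
    intro u v hu hu1 hv hv1
    have h0 := Real.mul_self_sqrt hy0.le
    constructor
    · rw [← h0]
      gcongr
    · exact mul_le_one₀ (Real.sqrt_le_one.mpr hu1) (Real.sqrt_nonneg v) (Real.sqrt_le_one.mpr hv1)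
  obtain ⟨hA, hA1⟩ := key ha ha1 hb hb1
  obtain ⟨hB, hB1⟩ := key hc hc1 hd hd1
  have hB0 : 0 < √c * √d := by linarith
  rw [div_sub_one hB0.ne', abs_div, abs_of_pos hB0]
  have h : |√a * √b - √c * √d| ≤ y := abs_le.mpr ⟨by linarith, by linarith⟩
  exact div_le_div₀ ((abs_nonneg _).trans h) h hy0 hB

theorem abs_d1_le {q : ℝ} (h0 : 0 < |q|) (h1 : |q| < 1) (r s : ℕ) (t : ℤ) :
    |d1 q r s t| ≤ (1 - |q| ^ 2)⁻¹ * |q| ^ (2 * r + 2 * s + t.natAbs) := by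
  have hpow : ∀ k : ℕ, q ^ (2 * k) = |q| ^ (2 * k) := fun k => by
    rw [pow_mul, pow_mul, sq_abs]
  have hle : ∀ {k : ℕ}, r + 1 ≤ k → 1 - |q| ^ (2 * (r + 1)) ≤ 1 - q ^ (2 * k) := fun {k} hk => by
    rw [hpow]
    exact sub_le_sub_left (pow_le_pow_of_le_one h0.le h1.le (by omega)) 1
  have hle1 : ∀ k : ℕ, 1 - q ^ (2 * k) ≤ 1 := fun k => by
    rw [hpow]
    exact sub_le_self 1 (by positivity)
  have hy : |q| ^ (2 * (r + 1)) < 1 := pow_lt_one₀ h0.le h1 (by omega)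
  have hq2 : |q| ^ 2 < 1 := pow_lt_one₀ h0.le h1 (by norm_num)
  have hyq : |q| ^ (2 * (r + 1)) ≤ |q| ^ 2 := pow_le_pow_of_le_one h0.le h1.le (by omega)
  have hbr := abs_sqrt_mul_sqrt_div_sub_one_le hy
    (hle (k := r + (-t).toNat + 1) (by omega)) (hle1 _)
    (hle (k := r + t.toNat + 1) (by omega)) (hle1 _)
    (hle (k := r + s + t.natAbs + 1) (by omega)) (hle1 _)
    (hle (k := r + s + t.natAbs + 2) (by omega)) (hle1 _)
  rw [d1, abs_mul, abs_pow]
  calc _ ≤ |q| ^ (2 * s + t.natAbs + 1) * (|q| ^ (2 * (r + 1)) / (1 - |q| ^ (2 * (r + 1)))) :=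
        mul_le_mul_of_nonneg_left hbr (by positivity)
    _ ≤ |q| ^ (2 * s + t.natAbs + 1) * (|q| ^ (2 * (r + 1)) / (1 - |q| ^ 2)) := by
        have : 0 < 1 - |q| ^ 2 := by linarith
        gcongr
    _ = (1 - |q| ^ 2)⁻¹ * |q| ^ (2 * r + 2 * s + t.natAbs + 3) := by ring
    _ ≤ _ := mul_le_mul_of_nonneg_left (pow_le_pow_of_le_one h0.le h1.le (by omega))
        (inv_nonneg.mpr (by linarith))

theorem summable_pow_two_mul_add_natAbs {x : ℝ} (h0 : 0 ≤ x) (h1 : x < 1) :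
    Summable fun i : ℕ × ℕ × ℤ => x ^ (2 * i.1 + 2 * i.2.1 + i.2.2.natAbs) := by
  have hN : Summable fun n : ℕ => x ^ (2 * n) := by
    simp_rw [pow_mul]
    exact summable_geometric_of_lt_one (sq_nonneg x) (pow_lt_one₀ h0 h1 (by norm_num))
  have hZ : Summable fun t : ℤ => x ^ t.natAbs := by
    apply Summable.of_nat_of_neg <;> simpa using summable_geometric_of_lt_one h0 h1
  have h := hN.mul_of_nonneg (hN.mul_of_nonneg hZ (fun _ => by positivity) fun _ => by positivity)
    (fun _ => by positivity) fun _ => by positivity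
  exact h.congr fun i => by rw [pow_add, pow_add, mul_assoc]

/-- the diagonal operator with symbol d₁ is compact; moreover
|d₁(r,s,t)| ≤ C·|q|^{2r+2s+|t|} for some C > 0. -/
theorem stmt12 (q : ℝ) (h0 : 0 < |q|) (h1 : |q| < 1) :
    (∃ D : l2Z3 →L[ℂ] l2Z3,
      (∀ (r s : ℕ) (t : ℤ), D (e3 r s t) = ((d1 q r s t : ℝ) : ℂ) • e3 r s t) ∧
      IsCompactOperator (⇑D)) ∧
    ∃ C : ℝ, 0 < C ∧ ∀ (r s : ℕ) (t : ℤ),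
      |d1 q r s t| ≤ C * |q| ^ (2 * r + 2 * s + t.natAbs) := by
  have hq2 : 0 < 1 - |q| ^ 2 := sub_pos.mpr (pow_lt_one₀ h0.le h1 (by norm_num))
  refine ⟨?_, (1 - |q| ^ 2)⁻¹, inv_pos.mpr hq2, abs_d1_le h0 h1⟩
  have hs : Summable fun i : ℕ × ℕ × ℤ => ‖((d1 q i.1 i.2.1 i.2.2 : ℝ) : ℂ)‖ := by
    refine Summable.of_nonneg_of_le (fun _ => norm_nonneg _) (fun i => ?_)
      ((summable_pow_two_mul_add_natAbs h0.le h1).mul_left (1 - |q| ^ 2)⁻¹)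
    rw [Complex.norm_real]
    exact abs_d1_le h0 h1 i.1 i.2.1 i.2.2
  obtain ⟨D, hD, hDc⟩ := exists_isCompactOperator_diagonal _ hs
  exact ⟨D, fun r s t => hD (r, s, t), hDc⟩
end
end

section
/- Let q be real with 0 < |q| < 1. Define d₄ : ℕ×ℕ×ℤ → ℝ by d₄(r,s,t) = q^s g(s+|t|+1) · [g(r+|t|+1)/(g(r+s+|t|+1)g(r+s+|t|+2)) − 1] for t ≥ 0, and d₄(r,s,t) = q^s g(s+|t|) · [g(r+|t|)/(g(r+s+|t|)g(r+s+|t|+1)) − 1] for t < 0. Then the diagonal operator on ℓ²(ℕ×ℕ×ℤ) with symbol d₄ is a compact operator. (Moreover there is a constant C > 0 with |d₄(r,s,t)| ≤ C·|q|^{r+s+|t|} for all (r,s,t).) -/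
noncomputable section

/-- d₄(r,s,t) = q^s g(s+|t|+1) [g(r+|t|+1)/(g(r+s+|t|+1)g(r+s+|t|+2)) − 1] for t ≥ 0,
and q^s g(s+|t|) [g(r+|t|)/(g(r+s+|t|)g(r+s+|t|+1)) − 1] for t < 0. -/
def d4 (q : ℝ) (r s : ℕ) (t : ℤ) : ℝ :=
  if t < 0 then
    q ^ s * gq q (s + t.natAbs) *
      (gq q (r + t.natAbs) / (gq q (r + s + t.natAbs) * gq q (r + s + t.natAbs + 1)) - 1)
  else
    q ^ s * gq q (s + t.natAbs + 1) *
      (gq q (r + t.natAbs + 1) / (gq q (r + s + t.natAbs + 1) * gq q (r + s + t.natAbs + 2)) - 1)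

open InnerProductSpace in
/-- An absolutely summable family of eigenvalues on an orthonormal family is realised by a compact
operator. -/
theorem exists_isCompactOperator_of_summable {ι E : Type*} [NormedAddCommGroup E]
    [InnerProductSpace ℂ E] [CompleteSpace E] {v : ι → E} (hv : Orthonormal ℂ v) {d : ι → ℂ}
    (hd : Summable fun i => ‖d i‖) :
    ∃ D : E →L[ℂ] E, (∀ i, D (v i) = d i • v i) ∧ IsCompactOperator (⇑D) := by
  classical
  have hs : Summable fun i => d i • rankOne ℂ (v i) (v i) := by
    refine Summable.of_norm ?_
    simpa [norm_smul, hv.1] using hd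
  refine ⟨∑' i, d i • rankOne ℂ (v i) (v i), fun j => ?_, ?_⟩
  · have h := hs.hasSum.mapL (ContinuousLinearMap.apply ℂ E (v j))
    refine h.unique ?_
    convert hasSum_ite_eq j (d j • v j) using 2 with i
    by_cases hij : i = j
    · subst hij
      simp [hv.1]
    · simp [hij, hv.2 hij]
  · refine isCompactOperator_of_tendsto hs.hasSum (Filter.Eventually.of_forall fun s => ?_)
    refine (compactOperator (RingHom.id ℂ) E E).sum_mem fun i _ => Submodule.smul_mem _ _ ?_
    exact (isCompactOperator_of_locallyCompactSpace_dom (innerSL ℂ (v i))).clm_comp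
      (ContinuousLinearMap.toSpanSingleton ℂ (v i))

theorem orthonormal_lp_single {ι : Type*} [DecidableEq ι] :
    Orthonormal ℂ fun i : ι => (lp.single 2 i (1 : ℂ) : lp (fun _ : ι => ℂ) 2) := by
  rw [orthonormal_iff_ite]
  intro i j
  rw [lp.inner_single_left, lp.single_apply]
  by_cases hij : i = j
  · subst hij
    simp
  · simp [hij]

theorem summable_pow_add_add_natAbs {a : ℝ} (ha0 : 0 ≤ a) (ha1 : a < 1) :
    Summable fun p : ℕ × ℕ × ℤ => a ^ (p.1 + p.2.1 + p.2.2.natAbs) := by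
  have hN : Summable fun n : ℕ => a ^ n := summable_geometric_of_lt_one ha0 ha1
  have hZ : Summable fun t : ℤ => a ^ t.natAbs :=
    Summable.of_nat_of_neg (by simpa using hN) (by simpa using hN)
  have hN0 : 0 ≤ fun n : ℕ => a ^ n := fun n => pow_nonneg ha0 n
  have hZ0 : 0 ≤ fun t : ℤ => a ^ t.natAbs := fun t => pow_nonneg ha0 t.natAbs
  have hNZ := hN.mul_of_nonneg hZ hN0 hZ0
  have hNZ0 : 0 ≤ fun p : ℕ × ℤ => a ^ p.1 * a ^ p.2.natAbs :=
    fun p => mul_nonneg (pow_nonneg ha0 p.1) (pow_nonneg ha0 p.2.natAbs)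
  refine (hN.mul_of_nonneg hNZ hN0 hNZ0).congr fun p => ?_
  rw [pow_add, pow_add, mul_assoc]

theorem gq_le_one (q : ℝ) (k : ℕ) : gq q k ≤ 1 :=
  Real.sqrt_le_one.2 (by linarith [(even_two_mul k).pow_nonneg q])

theorem gq_sq {q : ℝ} (hq : |q| ≤ 1) (k : ℕ) : gq q k ^ 2 = 1 - |q| ^ (2 * k) := by
  rw [gq, ← (even_two_mul k).pow_abs q,
    Real.sq_sqrt (sub_nonneg.2 (pow_le_one₀ (abs_nonneg q) hq))]

theorem gq_mono_s15 {q : ℝ} (hq : |q| ≤ 1) {k l : ℕ} (hkl : k ≤ l) : gq q k ≤ gq q l := by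
  refine (sq_le_sq₀ (gq_nonneg q k) (gq_nonneg q l)).1 ?_
  rw [gq_sq hq, gq_sq hq]
  exact sub_le_sub_left (pow_le_pow_of_le_one (abs_nonneg q) hq (by omega)) 1

/-- Both factors of the denominator exceed `gq q m`, so the quotient differs from `1` by at most
`|q| ^ (2 * m) / (1 - |q| ^ 2)`. -/
theorem abs_gq_div_sub_one_le {q : ℝ} (hq : |q| < 1) {m k l : ℕ} (hm : 1 ≤ m) (hk : m ≤ k)
    (hl : m ≤ l) :
    |gq q m / (gq q k * gq q l) - 1| ≤ (1 - |q| ^ 2)⁻¹ * |q| ^ (2 * m) := by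
  have h1 : 0 < 1 - |q| ^ 2 := sub_pos.2 (pow_lt_one₀ (abs_nonneg q) hq two_ne_zero)
  have hsq := gq_sq hq.le m
  have hm0 := gq_nonneg q m
  have hm1 := gq_le_one q m
  have hmk := gq_mono_s15 hq.le hk
  have hml := gq_mono_s15 hq.le hl
  have hden : gq q m ^ 2 ≤ gq q k * gq q l := by
    rw [sq]
    exact mul_le_mul hmk hml hm0 (hm0.trans hmk)
  have hden1 : gq q k * gq q l ≤ 1 :=
    mul_le_one₀ (gq_le_one q k) (gq_nonneg q l) (gq_le_one q l)
  have hlow : 1 - |q| ^ 2 ≤ gq q k * gq q l := by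
    refine le_trans ?_ hden
    rw [hsq]
    exact sub_le_sub_left (pow_le_pow_of_le_one (abs_nonneg q) hq.le (by omega)) 1
  have hpos := h1.trans_le hlow
  have hnum : |gq q m - gq q k * gq q l| ≤ |q| ^ (2 * m) := by
    rw [abs_le]
    constructor <;> nlinarith
  rw [div_sub_one hpos.ne', abs_div, abs_of_pos hpos, div_eq_inv_mul]
  exact mul_le_mul (inv_anti₀ h1 hlow) hnum (abs_nonneg _) (inv_nonneg.2 h1.le)

theorem abs_pow_mul_gq_mul_le {q : ℝ} (hq : |q| < 1) {j m k l n s : ℕ} (hm : 1 ≤ m) (hk : m ≤ k)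
    (hl : m ≤ l) (hn : n ≤ s + 2 * m) :
    |q ^ s * gq q j * (gq q m / (gq q k * gq q l) - 1)| ≤ (1 - |q| ^ 2)⁻¹ * |q| ^ n := by
  have h1 : 0 ≤ (1 - |q| ^ 2)⁻¹ :=
    inv_nonneg.2 (sub_nonneg.2 (pow_le_one₀ (abs_nonneg q) hq.le))
  rw [abs_mul, abs_mul, abs_pow, abs_of_nonneg (gq_nonneg q j)]
  calc |q| ^ s * gq q j * |gq q m / (gq q k * gq q l) - 1|
      ≤ |q| ^ s * 1 * ((1 - |q| ^ 2)⁻¹ * |q| ^ (2 * m)) := by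
        gcongr
        · exact gq_le_one q j
        · exact abs_gq_div_sub_one_le hq hm hk hl
    _ = (1 - |q| ^ 2)⁻¹ * |q| ^ (s + 2 * m) := by rw [pow_add]; ring
    _ ≤ (1 - |q| ^ 2)⁻¹ * |q| ^ n :=
        mul_le_mul_of_nonneg_left (pow_le_pow_of_le_one (abs_nonneg q) hq.le hn) h1

theorem abs_d4_le {q : ℝ} (hq : |q| < 1) (r s : ℕ) (t : ℤ) :
    |d4 q r s t| ≤ (1 - |q| ^ 2)⁻¹ * |q| ^ (r + s + t.natAbs) := by
  unfold d4
  split_ifs with ht <;>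
    exact abs_pow_mul_gq_mul_le hq (by omega) (by omega) (by omega) (by omega)

/-- the diagonal operator with symbol d₄ is compact; moreover
|d₄(r,s,t)| ≤ C·|q|^{r+s+|t|} for some C > 0. -/
theorem stmt15 (q : ℝ) (h0 : 0 < |q|) (h1 : |q| < 1) :
    (∃ D : l2Z3 →L[ℂ] l2Z3,
      (∀ (r s : ℕ) (t : ℤ), D (e3 r s t) = ((d4 q r s t : ℝ) : ℂ) • e3 r s t) ∧
      IsCompactOperator (⇑D)) ∧
    ∃ C : ℝ, 0 < C ∧ ∀ (r s : ℕ) (t : ℤ),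
      |d4 q r s t| ≤ C * |q| ^ (r + s + t.natAbs) := by
  have hpos : 0 < (1 - |q| ^ 2)⁻¹ :=
    inv_pos.2 (sub_pos.2 (pow_lt_one₀ (abs_nonneg q) h1 two_ne_zero))
  refine ⟨?_, _, hpos, abs_d4_le h1⟩
  have hs : Summable fun p : ℕ × ℕ × ℤ => ‖((d4 q p.1 p.2.1 p.2.2 : ℝ) : ℂ)‖ := by
    refine Summable.of_nonneg_of_le (fun _ => norm_nonneg _) (fun p => ?_)
      ((summable_pow_add_add_natAbs (abs_nonneg q) h1).mul_left (1 - |q| ^ 2)⁻¹)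
    rw [Complex.norm_real]
    exact abs_d4_le h1 _ _ _
  obtain ⟨D, hD, hc⟩ := exists_isCompactOperator_of_summable orthonormal_lp_single hs
  exact ⟨D, fun r s t => hD (r, s, t), hc⟩
end
end
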